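/- Let P be a finite Borel measure on Σ₂, let Λ be a Borel subset of Σ₂ with P(Λ) > 0, and let φ be any gauge function. If for P-almost every x ∈ Λ one has lim_{n→∞} (log₂ P[x₁ⁿ] − log₂ φ(2^{−n})) = −∞, then H^φ(Λ) = ∞. -/

import Mathlib

open MeasureTheory Filter Set

noncomputable section

/-- The symbolic space `Σ₂ = {0,1}^ℕ` (coordinates indexed from 0; coordinate `i` corresponds to
the paper's `x_{i+1}`). -/
def Sigma2 : Type := ℕ → Bool

/-- The metric `ρ(x,y) = 2^{-min{n : x_n ≠ y_n}}`. -/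
noncomputable instance : MetricSpace Sigma2 := PiNat.metricSpace (E := fun _ => Bool)

instance : MeasurableSpace Sigma2 := borel Sigma2

instance : BorelSpace Sigma2 := ⟨rfl⟩

/-- The cylinder `[x₁…xₙ]`: sequences agreeing with `x` on the first `n` coordinates. -/
def Cyl (x : Sigma2) (n : ℕ) : Set Sigma2 := {y : Sigma2 | ∀ i < n, y i = x i}

/-- A gauge function: continuous and increasing on `[0,∞)` with `φ(0) = 0`. -/
def IsGauge (φ : ℝ → ℝ) : Prop :=
  φ 0 = 0 ∧ ContinuousOn φ (Set.Ici 0) ∧ StrictMonoOn φ (Set.Ici 0)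

/-- The generalized Hausdorff measure with gauge `φ`. -/
def gaugeMeasure {X : Type*} [EMetricSpace X] [MeasurableSpace X] [BorelSpace X]
    (φ : ℝ → ℝ) : Measure X :=
  Measure.mkMetric fun d => ENNReal.ofReal (φ d.toReal)
theorem mem_Cyl_iff_dist_le {x y : Sigma2} {n : ℕ} :
    y ∈ Cyl x n ↔ dist y x ≤ (1 / 2) ^ n :=
  PiNat.mem_cylinder_iff_dist_le (E := fun _ => Bool)

theorem le_dist_of_notMem_Cyl_succ {x y : Sigma2} {n : ℕ} (hy : y ∉ Cyl x (n + 1)) :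
    (1 / 2 : ℝ) ^ n ≤ dist y x := by
  have hne : y ≠ x := by
    rintro rfl
    exact hy fun _ _ => rfl
  have hlt : PiNat.firstDiff (E := fun _ => Bool) y x < n + 1 := by
    by_contra! hle
    exact hy ((PiNat.mem_cylinder_iff_le_firstDiff (E := fun _ => Bool) hne (n + 1)).2 hle)
  have hdist : dist y x = (1 / 2 : ℝ) ^ PiNat.firstDiff (E := fun _ => Bool) y x :=
    PiNat.dist_eq_of_ne (E := fun _ => Bool) hne
  rw [hdist]
  exact pow_le_pow_of_le_one (by norm_num) (by norm_num) (by omega)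

theorem IsGauge.tendsto_half_pow {φ : ℝ → ℝ} (hφ : IsGauge φ) :
    Tendsto (fun n : ℕ => ENNReal.ofReal (φ ((1 / 2) ^ n))) atTop (nhds 0) := by
  have hpow : Tendsto (fun n : ℕ => (1 / 2 : ℝ) ^ n) atTop (nhdsWithin 0 (Ici 0)) :=
    tendsto_nhdsWithin_iff.2
      ⟨tendsto_pow_atTop_nhds_zero_of_lt_one (by norm_num) (by norm_num),
        Eventually.of_forall fun n => by simp⟩
  have h := ENNReal.tendsto_ofReal ((hφ.2.1 0 self_mem_Ici).tendsto.comp hpow)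
  simpa [hφ.1, Function.comp_def] using h

/-- If a point of a small set `U` satisfies the density bound at all scales from `N` on, then the
same bound holds for `U`. -/
theorem mul_measure_le_of_density {P : Measure Sigma2} {φ : ℝ → ℝ} (hφ : IsGauge φ)
    {K : ENNReal} {N : ℕ} {x : Sigma2} {U : Set Sigma2} (hxU : x ∈ U)
    (hx : ∀ n ≥ N, K * P (Cyl x n) ≤ ENNReal.ofReal (φ ((1 / 2) ^ n)))
    (hU : Metric.ediam U ≤ ENNReal.ofReal ((1 / 2) ^ N)) :
    K * P U ≤ ENNReal.ofReal (φ (Metric.ediam U).toReal) := by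
  have hfin : Metric.ediam U ≠ ⊤ := (hU.trans_lt ENNReal.ofReal_lt_top).ne
  have hdist : ∀ y ∈ U, dist y x ≤ (Metric.ediam U).toReal := fun y hy => by
    rw [dist_edist]
    exact ENNReal.toReal_mono hfin (Metric.edist_le_ediam_of_mem hy hxU)
  have hN : U ⊆ Cyl x N := fun y hy =>
    mem_Cyl_iff_dist_le.2 <| (hdist y hy).trans <| ENNReal.toReal_le_of_le_ofReal (by positivity) hU
  by_cases hall : ∀ n, N ≤ n → U ⊆ Cyl x n
  · have hzero : K * P U ≤ 0 := ge_of_tendsto hφ.tendsto_half_pow <| by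
      filter_upwards [eventually_ge_atTop N] with n hn
      exact (mul_le_mul_right (measure_mono (hall n hn)) K).trans (hx n hn)
    exact hzero.trans zero_le
  · obtain ⟨n, hn, hsub, hnot⟩ : ∃ n, N ≤ n ∧ U ⊆ Cyl x n ∧ ¬ U ⊆ Cyl x (n + 1) := by
      by_contra! hstep
      exact hall fun n hn => Nat.le_induction hN (fun m hm ih => hstep m hm ih) n hn
    obtain ⟨y, hyU, hy⟩ := not_subset.1 hnot
    have hle : (1 / 2 : ℝ) ^ n ≤ (Metric.ediam U).toReal :=
      (le_dist_of_notMem_Cyl_succ hy).trans (hdist y hyU)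
    calc K * P U ≤ K * P (Cyl x n) := by gcongr
      _ ≤ ENNReal.ofReal (φ ((1 / 2) ^ n)) := hx n hn
      _ ≤ ENNReal.ofReal (φ (Metric.ediam U).toReal) := by
        refine ENNReal.ofReal_le_ofReal (hφ.2.2.monotoneOn ?_ ?_ hle) <;>
          simp only [mem_Ici] <;> positivity

/-- A uniform density bound on `E` bounds the Hausdorff measure of `E` from below. -/
theorem mul_measure_le_gaugeMeasure {P : Measure Sigma2} {φ : ℝ → ℝ} (hφ : IsGauge φ)
    {K : NNReal} {N : ℕ} {E : Set Sigma2}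
    (hE : ∀ x ∈ E, ∀ n ≥ N, K * P (Cyl x n) ≤ ENNReal.ofReal (φ ((1 / 2) ^ n))) :
    K * P E ≤ gaugeMeasure φ E := by
  have hle : K • OuterMeasure.restrict E P.toOuterMeasure ≤
      OuterMeasure.mkMetric fun d => ENNReal.ofReal (φ d.toReal) := by
    refine OuterMeasure.le_mkMetric _ _ (ENNReal.ofReal ((1 / 2) ^ N)) (by simp) fun U hU => ?_
    have happ : (K • OuterMeasure.restrict E P.toOuterMeasure) U = K * P (U ∩ E) := by
      rw [smul_apply, OuterMeasure.restrict_apply, ENNReal.smul_def, smul_eq_mul,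
        Measure.coe_toOuterMeasure]
    rw [happ]
    obtain hemp | ⟨x, hxU, hxE⟩ := (U ∩ E).eq_empty_or_nonempty
    · simp [hemp]
    · exact (mul_le_mul_right (measure_mono inter_subset_left) _).trans
        (mul_measure_le_of_density hφ hxU (hE x hxE) hU)
  have h := hle E
  rw [smul_apply, OuterMeasure.restrict_apply, ENNReal.smul_def, smul_eq_mul,
    Measure.coe_toOuterMeasure, inter_self, OuterMeasure.coe_mkMetric] at h
  exact h

theorem eventually_mul_measure_Cyl_le {P : Measure Sigma2} [IsFiniteMeasure P] {φ : ℝ → ℝ}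
    (hφ : IsGauge φ) {x : Sigma2}
    (hx : Tendsto (fun n : ℕ =>
        Real.logb 2 (P (Cyl x n)).toReal - Real.logb 2 (φ ((2 : ℝ) ^ (-(n : ℤ)))))
      atTop atBot) (k : ℕ) :
    ∀ᶠ n : ℕ in atTop,
      ((2 ^ k : NNReal) : ENNReal) * P (Cyl x n) ≤ ENNReal.ofReal (φ ((1 / 2) ^ n)) := by
  filter_upwards [hx.eventually_le_atBot (-(k : ℝ))] with n hn
  have hpow : (2 : ℝ) ^ (-(n : ℤ)) = (1 / 2) ^ n := by simp
  rw [hpow] at hn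
  have hφpos : 0 < φ ((1 / 2) ^ n) := by
    have h := hφ.2.2 self_mem_Ici (show (1 / 2 : ℝ) ^ n ∈ Ici 0 by simp) (by positivity)
    rwa [hφ.1] at h
  rw [ENNReal.le_ofReal_iff_toReal_le (by finiteness) hφpos.le, ENNReal.toReal_mul]
  rcases (ENNReal.toReal_nonneg (a := P (Cyl x n))).eq_or_lt with h0 | h0
  · rw [← h0, mul_zero]
    exact hφpos.le
  · have hk : Real.logb 2 ((2 : ℝ) ^ k * (P (Cyl x n)).toReal) ≤
        Real.logb 2 (φ ((1 / 2) ^ n)) := by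
      rw [Real.logb_mul (by positivity) h0.ne', Real.logb_pow,
        Real.logb_self_eq_one (by norm_num)]
      linarith
    simpa using (Real.logb_le_logb (by norm_num) (by positivity) hφpos).1 hk

/-- If `P` is a finite Borel measure on `Σ₂`, `Λ` a Borel set with `P(Λ) > 0`, `φ` a gauge
function, and for `P`-a.e. `x ∈ Λ` one has
`log₂ P[x₁ⁿ] - log₂ φ(2^{-n}) → -∞`, then `H^φ(Λ) = ∞`. -/
theorem gaugeMeasure_infinite_of_ae_tendsto_atBot
    (P : Measure Sigma2) [IsFiniteMeasure P]
    (Λ : Set Sigma2) (hΛ : MeasurableSet Λ) (hpos : 0 < P Λ)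
    (φ : ℝ → ℝ) (hφ : IsGauge φ)
    (h : ∀ᵐ x ∂(P.restrict Λ),
      Tendsto (fun n : ℕ =>
          Real.logb 2 (P (Cyl x n)).toReal - Real.logb 2 (φ ((2 : ℝ) ^ (-(n : ℤ)))))
        atTop atBot) :
    gaugeMeasure φ Λ = ⊤ := by
  rw [ae_restrict_iff' hΛ] at h
  have hbound : ∀ k : ℕ, ((2 ^ k : NNReal) : ENNReal) * P Λ ≤ gaugeMeasure φ Λ := by
    intro k
    let E : ℕ → Set Sigma2 := fun N => {x ∈ Λ | ∀ n ≥ N,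
      ((2 ^ k : NNReal) : ENNReal) * P (Cyl x n) ≤ ENNReal.ofReal (φ ((1 / 2) ^ n))}
    have hmono : Monotone E := fun M N hMN x hx => ⟨hx.1, fun n hn => hx.2 n (hMN.trans hn)⟩
    have hcover : P Λ ≤ P (⋃ N, E N) := by
      refine measure_mono_ae ?_
      filter_upwards [h] with x hx hxΛ
      obtain ⟨N, hN⟩ := eventually_atTop.1 (eventually_mul_measure_Cyl_le hφ (hx hxΛ) k)
      exact mem_iUnion.2 ⟨N, hxΛ, hN⟩
    calc ((2 ^ k : NNReal) : ENNReal) * P Λ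
        ≤ ((2 ^ k : NNReal) : ENNReal) * P (⋃ N, E N) := by gcongr
      _ = ⨆ N, ((2 ^ k : NNReal) : ENNReal) * P (E N) := by
        rw [hmono.measure_iUnion, ENNReal.mul_iSup]
      _ ≤ gaugeMeasure φ Λ := iSup_le fun N =>
        (mul_measure_le_gaugeMeasure hφ fun x hx => hx.2).trans (measure_mono fun x hx => hx.1)
  have hlim : Tendsto (fun k : ℕ => ((2 ^ k : NNReal) : ENNReal) * P Λ) atTop (nhds ⊤) := by
    have hpow : Tendsto (fun k : ℕ => ((2 ^ k : NNReal) : ENNReal)) atTop (nhds ⊤) :=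
      ENNReal.tendsto_coe_nhds_top.2 (tendsto_pow_atTop_atTop_of_one_lt one_lt_two)
    have hmul := ENNReal.Tendsto.mul_const (b := P Λ) hpow (Or.inl ENNReal.top_ne_zero)
    rwa [ENNReal.top_mul hpos.ne'] at hmul
  exact top_le_iff.1 (le_of_tendsto' hlim hbound)

end
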